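/- The computational order on 𝔸₁, defined by x ≪ y iff x ∇ y = y, is a partial order: it is reflexive, antisymmetric and transitive. -/

import Mathlib

open scoped BigOperators

/-- A generalized affine form: an `ℓ¹` family of noise coefficients `α` together with a
perturbation coefficient `β`. -/
structure AffineForm where
  α : ℕ → ℝ
  β : ℝ
  hsum : Summable fun i => |α i|

namespace AffineForm

/-- `ℓ¹` distance between the `α`-parts of two forms. -/
noncomputable def distL (x y : AffineForm) : ℝ := ∑' i, |x.α i - y.α i|

/-- `ℓ¹` norm of the `α`-part. -/
noncomputable def normA (x : AffineForm) : ℝ := ∑' i, |x.α i|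

/-- Total deviation of the noise part (indices `i ≥ 1`). -/
noncomputable def dev (x : AffineForm) : ℝ := ∑' i, |x.α (i + 1)|

/-- The perturbation order: `x ≤ y` iff `‖αˣ - αʸ‖₁ ≤ βʸ - βˣ`. -/
def le (x y : AffineForm) : Prop := distL x y ≤ y.β - x.β

/-- Lower bound of the concretization. -/
noncomputable def lo (x : AffineForm) : ℝ := x.α 0 - dev x - x.β

/-- Upper bound of the concretization. -/
noncomputable def hi (x : AffineForm) : ℝ := x.α 0 + dev x + x.β

/-- The concretization interval. -/
noncomputable def γ (x : AffineForm) : Set ℝ := Set.Icc (lo x) (hi x)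

/-- Point of `[min a b, max a b]` of minimal absolute value. -/
noncomputable def argmin (a b : ℝ) : ℝ :=
  if a * b ≤ 0 then 0 else if |a| ≤ |b| then a else b

lemma abs_argmin_le (a b : ℝ) : |argmin a b| ≤ |a| + |b| := by
  unfold argmin
  split_ifs with h1 h2
  · simpa using add_nonneg (abs_nonneg a) (abs_nonneg b)
  · linarith [abs_nonneg b]
  · linarith [abs_nonneg a]

/-- The widening `x ∇ y`. -/
noncomputable def widen (x y : AffineForm) : AffineForm where
  α := fun i =>
    if i = 0 then (min (lo x) (lo y) + max (hi x) (hi y)) / 2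
    else argmin (x.α i) (y.α i)
  β := max (hi x) (hi y) - (min (lo x) (lo y) + max (hi x) (hi y)) / 2
        - ∑' i, |argmin (x.α (i + 1)) (y.α (i + 1))|
  hsum := by
    have hc : Summable fun i : ℕ =>
        (if i = 0 then |(min (lo x) (lo y) + max (hi x) (hi y)) / 2| else 0 : ℝ) :=
      summable_of_ne_finset_zero (s := {0}) (by
        intro i hi
        simp only [Finset.mem_singleton] at hi
        simp [hi])
    refine Summable.of_nonneg_of_le (fun i => abs_nonneg _) (fun i => ?_)
      ((x.hsum.add y.hsum).add hc)
    by_cases h0 : i = 0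
    · subst h0
      simp only [reduceIte]
      linarith [abs_nonneg (x.α 0), abs_nonneg (y.α 0)]
    · simp only [if_neg h0, add_zero]
      exact abs_argmin_le _ _

/-- The computational order: `x ≪ y` iff `x ∇ y = y`. -/
def ll (x y : AffineForm) : Prop := widen x y = y

lemma argmin_eq_right_iff (a b : ℝ) :
    argmin a b = b ↔ (0 ≤ b ∧ b ≤ a) ∨ (a ≤ b ∧ b ≤ 0) := by
  unfold argmin
  split_ifs with h1 h2
  · constructor
    · rintro rfl
      exact (le_total 0 a).imp (fun h => ⟨le_rfl, h⟩) (fun h => ⟨h, le_rfl⟩)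
    · rintro (⟨h, h'⟩ | ⟨h, h'⟩) <;> nlinarith
  · constructor
    · rintro rfl
      exact (le_total 0 a).imp (fun h => ⟨h, le_rfl⟩) (fun h => ⟨le_rfl, h⟩)
    · rintro (⟨h, h'⟩ | ⟨h, h'⟩)
      · rw [abs_of_nonneg h, abs_of_nonneg (h.trans h')] at h2
        exact le_antisymm h2 h'
      · rw [abs_of_nonpos h', abs_of_nonpos (h.trans h')] at h2
        linarith
  · simp only [true_iff]
    push Not at h1 h2
    rcases pos_and_pos_or_neg_and_neg_of_mul_pos h1 with ⟨ha, hb⟩ | ⟨ha, hb⟩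
    · rw [abs_of_pos ha, abs_of_pos hb] at h2
      exact Or.inl ⟨hb.le, h2.le⟩
    · rw [abs_of_neg ha, abs_of_neg hb] at h2
      exact Or.inr ⟨by linarith, hb.le⟩

lemma ext_of_coeff {x y : AffineForm} (hα : x.α = y.α) (hβ : x.β = y.β) : x = y := by
  cases x
  cases y
  subst hα hβ
  rfl

/-- `x ≪ y` means that `γ(x)` lies within the bounds of `γ(y)` and every noise coefficient of `y`
lies between `0` and the corresponding coefficient of `x`. -/
lemma ll_iff (x y : AffineForm) :
    ll x y ↔ lo y ≤ lo x ∧ hi x ≤ hi y ∧ ∀ i, argmin (x.α (i + 1)) (y.α (i + 1)) = y.α (i + 1) := by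
  constructor
  · intro h
    have h0 : (min (lo x) (lo y) + max (hi x) (hi y)) / 2 = y.α 0 :=
      congrFun (congrArg AffineForm.α h) 0
    have hs (i : ℕ) : argmin (x.α (i + 1)) (y.α (i + 1)) = y.α (i + 1) :=
      congrFun (congrArg AffineForm.α h) (i + 1)
    have hβ : max (hi x) (hi y) - (min (lo x) (lo y) + max (hi x) (hi y)) / 2
        - ∑' i, |argmin (x.α (i + 1)) (y.α (i + 1))| = y.β := congrArg AffineForm.β h
    simp only [hs] at hβ
    have hmax : max (hi x) (hi y) = hi y := by
      change _ = y.α 0 + ∑' i, |y.α (i + 1)| + y.β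
      linarith
    have hmin : min (lo x) (lo y) = lo y := by
      have hhi : hi y = y.α 0 + dev y + y.β := rfl
      have hlo : lo y = y.α 0 - dev y - y.β := rfl
      linarith
    exact ⟨min_eq_right_iff.mp hmin, max_eq_right_iff.mp hmax, hs⟩
  · rintro ⟨hlo, hhi, hs⟩
    have h0 : (lo y + hi y) / 2 = y.α 0 := by
      unfold lo hi
      ring
    refine ext_of_coeff (funext fun i => ?_) ?_
    · cases i with
      | zero => simp [widen, min_eq_right hlo, max_eq_right hhi, h0]
      | succ i => simp [widen, hs]
    · simp only [widen, min_eq_right hlo, max_eq_right hhi, h0, hs]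
      unfold hi dev
      ring

lemma ll_refl (x : AffineForm) : ll x x :=
  (ll_iff x x).mpr ⟨le_rfl, le_rfl, fun i => (argmin_eq_right_iff _ _).mpr <|
    (le_total 0 (x.α (i + 1))).imp (fun h => ⟨h, le_rfl⟩) (fun h => ⟨le_rfl, h⟩)⟩

lemma ll_antisymm {x y : AffineForm} (hxy : ll x y) (hyx : ll y x) : x = y := by
  obtain ⟨hlo, hhi, hs⟩ := (ll_iff x y).mp hxy
  obtain ⟨hlo', hhi', hs'⟩ := (ll_iff y x).mp hyx
  have hα (i : ℕ) : x.α (i + 1) = y.α (i + 1) := by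
    rcases (argmin_eq_right_iff _ _).mp (hs i) with ⟨_, _⟩ | ⟨_, _⟩ <;>
    rcases (argmin_eq_right_iff _ _).mp (hs' i) with ⟨_, _⟩ | ⟨_, _⟩ <;> linarith
  have hdev : dev x = dev y := by simp only [dev, hα]
  unfold lo at hlo hlo'
  unfold hi at hhi hhi'
  refine ext_of_coeff (funext fun i => ?_) (by linarith)
  cases i with
  | zero => linarith
  | succ i => exact hα i

lemma ll_trans {x y z : AffineForm} (hxy : ll x y) (hyz : ll y z) : ll x z := by
  obtain ⟨hlo, hhi, hs⟩ := (ll_iff x y).mp hxy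
  obtain ⟨hlo', hhi', hs'⟩ := (ll_iff y z).mp hyz
  refine (ll_iff x z).mpr ⟨hlo'.trans hlo, hhi.trans hhi', fun i => ?_⟩
  rw [argmin_eq_right_iff]
  rcases (argmin_eq_right_iff _ _).mp (hs i) with ⟨_, _⟩ | ⟨_, _⟩ <;>
  rcases (argmin_eq_right_iff _ _).mp (hs' i) with ⟨_, _⟩ | ⟨_, _⟩
  · exact Or.inl ⟨by linarith, by linarith⟩
  · rcases le_total 0 (x.α (i + 1)) with h | h
    · exact Or.inl ⟨by linarith, by linarith⟩
    · exact Or.inr ⟨by linarith, by linarith⟩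
  · rcases le_total 0 (x.α (i + 1)) with h | h
    · exact Or.inl ⟨by linarith, by linarith⟩
    · exact Or.inr ⟨by linarith, by linarith⟩
  · exact Or.inr ⟨by linarith, by linarith⟩

/-- The computational order `≪` is a partial order on `𝔸₁`. -/
theorem computational_order_is_partial_order :
    (∀ x : AffineForm, ll x x) ∧
    (∀ x y : AffineForm, ll x y → ll y x → x = y) ∧
    (∀ x y z : AffineForm, ll x y → ll y z → ll x z) := by
  exact ⟨ll_refl, fun _ _ => ll_antisymm, fun _ _ _ => ll_trans⟩

end AffineForm
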